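/- arXiv:2012.10261 — 9 statements merged into one kernel-verified Lean document; each statement's English description precedes it below -/
import Mathlib

section
/- Consider N ≥ 2 planar double-integrator agents with positions ξ_i ∈ ℝ², velocities v_i ∈ ℝ², and acceleration inputs u_i ∈ ℝ². Suppose the state lies in the admissible set C*. Then the braking policy u_i = −λ₁ v_i for every i satisfies all pairwise centralized barrier constraints with margin: for all i ≠ j, a_ij + b_ij(u_i − u_j) ≥ 2‖v_ij‖² ≥ 0. In particular the Centralized QP constraint set {(u_1,…,u_N) : a_ij + b_ij(u_i − u_j) ≥ 0 for all i ≠ j} is nonempty whenever the state is in C*. -/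
open scoped InnerProductSpace

/-- Constraint data `a_ij` for the pairwise barrier between agents `i` and `j`. -/
noncomputable def aConstr {N : ℕ} (r l₀ l₁ : ℝ)
    (ξ v : Fin N → EuclideanSpace ℝ (Fin 2)) (i j : Fin N) : ℝ :=
  2 * ‖v i - v j‖ ^ 2 + 2 * l₁ * ⟪ξ i - ξ j, v i - v j⟫_ℝ
    + l₀ * (‖ξ i - ξ j‖ ^ 2 - r ^ 2)

/-- Constraint row `b_ij u = 2 ξ_ijᵀ u`. -/
noncomputable def bConstr {N : ℕ} (ξ : Fin N → EuclideanSpace ℝ (Fin 2))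
    (i j : Fin N) (u : EuclideanSpace ℝ (Fin 2)) : ℝ :=
  2 * ⟪ξ i - ξ j, u⟫_ℝ

/-- The admissible set `C*`: for all `i ≠ j`, `h_ij ≥ 0` and `ḣ_ij + λ₁ h_ij ≥ 0`. -/
def admissible {N : ℕ} (r lam : ℝ) (ξ v : Fin N → EuclideanSpace ℝ (Fin 2)) : Prop :=
  ∀ i j : Fin N, i ≠ j →
    ‖ξ i - ξ j‖ ^ 2 - r ^ 2 ≥ 0 ∧
    2 * ⟪ξ i - ξ j, v i - v j⟫_ℝ + lam * (‖ξ i - ξ j‖ ^ 2 - r ^ 2) ≥ 0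

/-- The larger root `lam` of `s ^ 2 - l₁ * s + l₀` satisfies `(l₁ - lam) * lam = l₀`, and the
complementary root `l₁ - lam` is nonnegative. -/
lemma larger_root_mul_and_nonneg {l₀ l₁ lam : ℝ} (hl₀ : 0 < l₀) (hl₁ : 0 < l₁)
    (hdisc : l₁ ^ 2 ≥ 4 * l₀) (hlam : lam = (l₁ + Real.sqrt (l₁ ^ 2 - 4 * l₀)) / 2) :
    (l₁ - lam) * lam = l₀ ∧ 0 ≤ l₁ - lam := by
  have hsq : Real.sqrt (l₁ ^ 2 - 4 * l₀) ^ 2 = l₁ ^ 2 - 4 * l₀ := Real.sq_sqrt (by linarith)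
  have hle : Real.sqrt (l₁ ^ 2 - 4 * l₀) ≤ l₁ := Real.sqrt_le_iff.mpr ⟨hl₁.le, by linarith⟩
  subst hlam
  exact ⟨by linear_combination (-1 / 4) * hsq, by linarith⟩

/-- Under braking inputs, the pairwise constraint splits into the margin `2‖v_ij‖²` and a multiple
of `ḣ_ij + lam * h_ij`. -/
lemma aConstr_add_bConstr_braking {N : ℕ} {r l₀ l₁ lam : ℝ} (hroot : (l₁ - lam) * lam = l₀)
    (ξ v : Fin N → EuclideanSpace ℝ (Fin 2)) (i j : Fin N) :
    aConstr r l₀ l₁ ξ v i j + bConstr ξ i j ((-lam) • v i - (-lam) • v j) =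
      2 * ‖v i - v j‖ ^ 2 + (l₁ - lam) *
        (2 * ⟪ξ i - ξ j, v i - v j⟫_ℝ + lam * (‖ξ i - ξ j‖ ^ 2 - r ^ 2)) := by
  rw [aConstr, bConstr, ← smul_sub, real_inner_smul_right]
  linear_combination (-(‖ξ i - ξ j‖ ^ 2 - r ^ 2)) * hroot

/-- The braking policy `u_i = -λ₁ v_i` satisfies all pairwise centralized barrier
constraints with margin `2‖v_ij‖²`; in particular the Centralized QP constraint
set is nonempty on the admissible set `C*`. -/
theorem centralized_qp_braking_feasible
    (N : ℕ) (hN : 2 ≤ N)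
    (r l₀ l₁ lam : ℝ) (hr : 0 < r) (hl₀ : 0 < l₀) (hl₁ : 0 < l₁)
    (hdisc : l₁ ^ 2 ≥ 4 * l₀)
    (hlam : lam = (l₁ + Real.sqrt (l₁ ^ 2 - 4 * l₀)) / 2)
    (ξ v : Fin N → EuclideanSpace ℝ (Fin 2))
    (hadm : admissible r lam ξ v) :
    (∀ i j : Fin N, i ≠ j →
      aConstr r l₀ l₁ ξ v i j
          + bConstr ξ i j ((-lam) • v i - (-lam) • v j) ≥ 2 * ‖v i - v j‖ ^ 2
      ∧ 2 * ‖v i - v j‖ ^ 2 ≥ 0)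
    ∧ ∃ u : Fin N → EuclideanSpace ℝ (Fin 2),
        ∀ i j : Fin N, i ≠ j →
          aConstr r l₀ l₁ ξ v i j + bConstr ξ i j (u i - u j) ≥ 0 := by
  obtain ⟨hroot, hnn⟩ := larger_root_mul_and_nonneg hl₀ hl₁ hdisc hlam
  have margin : ∀ i j : Fin N, i ≠ j →
      aConstr r l₀ l₁ ξ v i j + bConstr ξ i j ((-lam) • v i - (-lam) • v j) ≥
        2 * ‖v i - v j‖ ^ 2 ∧ 2 * ‖v i - v j‖ ^ 2 ≥ 0 := by
    intro i j hij
    rw [aConstr_add_bConstr_braking hroot]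
    exact ⟨le_add_of_nonneg_right (mul_nonneg hnn (hadm i j hij).2), by positivity⟩
  exact ⟨margin, fun i => (-lam) • v i,
    fun i j hij => (margin i j hij).2.le.trans (margin i j hij).1⟩
end

section
/- Let ξ, v ∈ ℝ² and let l₀ > 0, l₁ > 0 with l₁² ≥ 4 l₀, and λ₁ = (l₁ + √(l₁² − 4 l₀))/2. Set h = ‖ξ‖² − r² and a = 2‖v‖² + 2 l₁ ξᵀv + l₀ h. Suppose λ₁ h + 2 ξᵀv ≥ 0. Then any pair of control inputs u_i, u_j ∈ ℝ² satisfying u_i − u_j = −λ₁ v yields a + 2 ξᵀ(u_i − u_j) ≥ 2‖v‖² ≥ 0, i.e., the pairwise barrier constraint is satisfied with margin 2‖v‖². -/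
open scoped InnerProductSpace

/-- With `h = ‖ξ‖² − r²` and `a = 2‖v‖² + 2 l₁ ξᵀv + l₀ h`, if the state
satisfies `λ₁ h + 2 ξᵀv ≥ 0`, then any pair of controls with
`u_i − u_j = −λ₁ v` satisfies the pairwise barrier constraint with margin
`2‖v‖²`: `a + 2 ξᵀ(u_i − u_j) ≥ 2‖v‖² ≥ 0`. -/
theorem pairwise_barrier_margin
    (r l₀ l₁ lam : ℝ) (hr : 0 < r) (hl₀ : 0 < l₀) (hl₁ : 0 < l₁)
    (hdisc : l₁ ^ 2 ≥ 4 * l₀)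
    (hlam : lam = (l₁ + Real.sqrt (l₁ ^ 2 - 4 * l₀)) / 2)
    (ξ v : EuclideanSpace ℝ (Fin 2))
    (hC : lam * (‖ξ‖ ^ 2 - r ^ 2) + 2 * ⟪ξ, v⟫_ℝ ≥ 0)
    (ui uj : EuclideanSpace ℝ (Fin 2))
    (huij : ui - uj = (-lam) • v) :
    (2 * ‖v‖ ^ 2 + 2 * l₁ * ⟪ξ, v⟫_ℝ + l₀ * (‖ξ‖ ^ 2 - r ^ 2))
        + 2 * ⟪ξ, ui - uj⟫_ℝ ≥ 2 * ‖v‖ ^ 2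
    ∧ 2 * ‖v‖ ^ 2 ≥ 0 := by
  have hsq : Real.sqrt (l₁ ^ 2 - 4 * l₀) ^ 2 = l₁ ^ 2 - 4 * l₀ :=
    Real.sq_sqrt (by linarith)
  have hle : Real.sqrt (l₁ ^ 2 - 4 * l₀) ≤ l₁ :=
    Real.sqrt_le_iff.mpr ⟨hl₁.le, by linarith⟩
  have hother : 0 ≤ l₁ - lam := by rw [hlam]; linarith
  have hprod : (l₁ - lam) * lam = l₀ := by
    rw [hlam]
    linear_combination -hsq / 4
  refine ⟨?_, by positivity⟩
  rw [huij, real_inner_smul_right, ← hprod]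
  linarith [mul_nonneg hother hC]
end

section
/- Consider N ≥ 2 planar double-integrator agents with positions ξ_i ∈ ℝ² and velocities v_i ∈ ℝ², with state in the admissible set C*. For ANY prescribed control u_1 ∈ ℝ² of agent 1 (e.g., a non-interacting agent with known acceleration), the choice u_j = u_1 + λ₁ (v_1 − v_j) for j = 2,…,N satisfies all pairwise centralized barrier constraints with margin: a_ij + b_ij(u_i − u_j) ≥ 2‖v_ij‖² ≥ 0 for all i ≠ j (including pairs involving agent 1). -/
open scoped InnerProductSpace

/-- For any prescribed control `u₁` of agent `1` (index `0`), the choice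
`u_j = u₁ + λ₁ (v₁ − v_j)` for the remaining agents satisfies all pairwise
centralized barrier constraints with margin `2‖v_ij‖² ≥ 0`, including pairs
involving agent `1`. -/
theorem centralized_feasible_with_prescribed_agent
    (N : ℕ) (hN : 2 ≤ N)
    (r l₀ l₁ lam : ℝ) (hr : 0 < r) (hl₀ : 0 < l₀) (hl₁ : 0 < l₁)
    (hdisc : l₁ ^ 2 ≥ 4 * l₀)
    (hlam : lam = (l₁ + Real.sqrt (l₁ ^ 2 - 4 * l₀)) / 2)
    (ξ v : Fin N → EuclideanSpace ℝ (Fin 2))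
    (hadm : admissible r lam ξ v)
    (a₁ : Fin N) (u₁ : EuclideanSpace ℝ (Fin 2))
    (u : Fin N → EuclideanSpace ℝ (Fin 2))
    (hu : ∀ j : Fin N, u j = u₁ + lam • (v a₁ - v j)) :
    ∀ i j : Fin N, i ≠ j →
      aConstr r l₀ l₁ ξ v i j + bConstr ξ i j (u i - u j) ≥ 2 * ‖v i - v j‖ ^ 2
      ∧ 2 * ‖v i - v j‖ ^ 2 ≥ 0 := by
  intro i j hij
  refine ⟨?_, by positivity⟩
  have hsqrt : Real.sqrt (l₁ ^ 2 - 4 * l₀) ^ 2 = l₁ ^ 2 - 4 * l₀ :=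
    Real.sq_sqrt (by linarith)
  have hle : Real.sqrt (l₁ ^ 2 - 4 * l₀) ≤ l₁ :=
    Real.sqrt_le_iff.mpr ⟨hl₁.le, by linarith⟩
  have hroot : 0 ≤ l₁ - lam := by linarith
  have hprod : (l₁ - lam) * lam = l₀ := by
    rw [hlam]
    linear_combination (-1 / 4 : ℝ) * hsqrt
  have hdiff : u i - u j = (-lam) • (v i - v j) := by
    rw [hu i, hu j]
    module
  have hmargin := mul_nonneg hroot (hadm i j hij).2
  rw [aConstr, bConstr, hdiff, inner_smul_right, ← hprod]
  linarith
end

section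
/- Consider N ≥ 2 planar double-integrator agents with state in the admissible set C*, and baseline controls u_{01},…,u_{0N} ∈ ℝ². Then the Centralized QP — minimize Σ_{i=1}^N ‖u_i − u_{0i}‖² over (u_1,…,u_N) ∈ (ℝ²)^N subject to a_ij + b_ij(u_i − u_j) ≥ 0 for all i ≠ j — is feasible and has a unique minimizer. -/
open scoped InnerProductSpace

/-- Feasible set of the Centralized QP. -/
def centralizedFeasible {N : ℕ} (r l₀ l₁ : ℝ)
    (ξ v : Fin N → EuclideanSpace ℝ (Fin 2))
    (u : Fin N → EuclideanSpace ℝ (Fin 2)) : Prop :=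
  ∀ i j : Fin N, i ≠ j → aConstr r l₀ l₁ ξ v i j + bConstr ξ i j (u i - u j) ≥ 0

/-- Cost of the Centralized QP: `Σ_i ‖u_i − u_{0i}‖²`. -/
noncomputable def centralizedCost {N : ℕ}
    (u₀ u : Fin N → EuclideanSpace ℝ (Fin 2)) : ℝ :=
  ∑ i : Fin N, ‖u i - u₀ i‖ ^ 2

/-- Projection onto a nonempty closed convex set, with the quadratic growth estimate. -/
theorem exists_mem_norm_sub_sq_add_norm_sub_sq_le {E : Type*} [NormedAddCommGroup E]
    [InnerProductSpace ℝ E] [CompleteSpace E] {K : Set E} (hne : K.Nonempty)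
    (hclosed : IsClosed K) (hconv : Convex ℝ K) (x : E) :
    ∃ p ∈ K, ∀ w ∈ K, ‖p - x‖ ^ 2 + ‖w - p‖ ^ 2 ≤ ‖w - x‖ ^ 2 := by
  obtain ⟨p, hp, hmin⟩ := exists_norm_eq_iInf_of_complete_convex hne hclosed.isComplete hconv x
  refine ⟨p, hp, fun w hw => ?_⟩
  have hinner := (norm_eq_iInf_iff_real_inner_le_zero hconv hp).1 hmin w hw
  have hexp := norm_sub_sq_real (w - p) (x - p)
  rw [sub_sub_sub_cancel_right, norm_sub_rev x p, real_inner_comm] at hexp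
  linarith

/-- Damping every velocity by `l₁` satisfies all pairwise constraints. -/
theorem centralizedFeasible_neg_smul {N : ℕ} {r l₀ l₁ : ℝ} (hl₀ : 0 ≤ l₀)
    {ξ v : Fin N → EuclideanSpace ℝ (Fin 2)}
    (hsep : ∀ i j, i ≠ j → 0 ≤ ‖ξ i - ξ j‖ ^ 2 - r ^ 2) :
    centralizedFeasible r l₀ l₁ ξ v fun i => -(l₁ • v i) := by
  intro i j hij
  have hu : -(l₁ • v i) - -(l₁ • v j) = -(l₁ • (v i - v j)) := by
    rw [smul_sub]; abel
  simp only [aConstr, bConstr, hu, inner_neg_right, inner_smul_right]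
  nlinarith [mul_nonneg hl₀ (hsep i j hij), sq_nonneg ‖v i - v j‖]

theorem convex_centralizedFeasible {N : ℕ} (r l₀ l₁ : ℝ)
    (ξ v : Fin N → EuclideanSpace ℝ (Fin 2)) :
    Convex ℝ {u : PiLp 2 fun _ : Fin N => EuclideanSpace ℝ (Fin 2) |
      centralizedFeasible r l₀ l₁ ξ v u.ofLp} := by
  intro x hx y hy a b ha hb hab i j hij
  have hxij := mul_nonneg ha (hx i j hij)
  have hyij := mul_nonneg hb (hy i j hij)
  simp only [bConstr, inner_sub_right] at hxij hyij
  simp only [bConstr, PiLp.add_apply, PiLp.smul_apply, inner_sub_right, inner_add_right,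
    inner_smul_right]
  linear_combination hxij + hyij + aConstr r l₀ l₁ ξ v i j * hab

theorem isClosed_centralizedFeasible {N : ℕ} (r l₀ l₁ : ℝ)
    (ξ v : Fin N → EuclideanSpace ℝ (Fin 2)) :
    IsClosed {u : PiLp 2 fun _ : Fin N => EuclideanSpace ℝ (Fin 2) |
      centralizedFeasible r l₀ l₁ ξ v u.ofLp} := by
  simp only [centralizedFeasible, bConstr, ge_iff_le, Set.ofPred_forall]
  exact isClosed_iInter fun i => isClosed_iInter fun j => isClosed_iInter fun _ =>
    isClosed_le continuous_const (by fun_prop)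

/-- On the admissible set `C*`, the Centralized QP is feasible and has a
unique minimizer. -/
theorem centralized_qp_feasible_unique_minimizer
    (N : ℕ) (hN : 2 ≤ N)
    (r l₀ l₁ lam : ℝ) (hr : 0 < r) (hl₀ : 0 < l₀) (hl₁ : 0 < l₁)
    (hdisc : l₁ ^ 2 ≥ 4 * l₀)
    (hlam : lam = (l₁ + Real.sqrt (l₁ ^ 2 - 4 * l₀)) / 2)
    (ξ v : Fin N → EuclideanSpace ℝ (Fin 2))
    (hadm : admissible r lam ξ v)
    (u₀ : Fin N → EuclideanSpace ℝ (Fin 2)) :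
    ∃ ustar : Fin N → EuclideanSpace ℝ (Fin 2),
      centralizedFeasible r l₀ l₁ ξ v ustar ∧
      (∀ u, centralizedFeasible r l₀ l₁ ξ v u →
        centralizedCost u₀ ustar ≤ centralizedCost u₀ u) ∧
      (∀ u, centralizedFeasible r l₀ l₁ ξ v u →
        centralizedCost u₀ u = centralizedCost u₀ ustar → u = ustar) := by
  obtain ⟨p, hp, hgrowth⟩ := exists_mem_norm_sub_sq_add_norm_sub_sq_le
    ⟨WithLp.toLp 2 _, centralizedFeasible_neg_smul hl₀.le fun i j hij => (hadm i j hij).1⟩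
    (isClosed_centralizedFeasible r l₀ l₁ ξ v) (convex_centralizedFeasible r l₀ l₁ ξ v)
    (WithLp.toLp 2 u₀)
  have hcost : ∀ w : PiLp 2 fun _ : Fin N => EuclideanSpace ℝ (Fin 2),
      centralizedCost u₀ w.ofLp = ‖w - WithLp.toLp 2 u₀‖ ^ 2 := fun w => by
    simp [centralizedCost, PiLp.norm_sq_eq_of_L2]
  refine ⟨p.ofLp, hp, fun u hu => ?_, fun u hu heq => ?_⟩
  · have h := hgrowth (WithLp.toLp 2 u) hu
    rw [← hcost, ← hcost] at h
    linarith [sq_nonneg ‖WithLp.toLp 2 u - p‖]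
  · have h := hgrowth (WithLp.toLp 2 u) hu
    rw [← hcost, ← hcost, heq] at h
    have hzero : ‖WithLp.toLp 2 u - p‖ = 0 :=
      pow_eq_zero_iff two_ne_zero |>.1 (by linarith [sq_nonneg ‖WithLp.toLp 2 u - p‖])
    exact congrArg WithLp.ofLp (sub_eq_zero.1 (norm_eq_zero.1 hzero))
end

section
/- Consider N ≥ 2 planar double-integrator agents with state in the admissible set C*, a host agent index i, and a baseline control u_{0i} ∈ ℝ² known only to the host. Then the CCS2 constraint set is nonempty: there exist u_{i1},…,u_{iN} ∈ ℝ² such that a_ij + 2 b_ij u_{0i} + b_ij(u_{ii} − u_{ij}) ≥ 0 for all j ≠ i, and a_jk + b_jk(u_{ij} − u_{ik}) ≥ 0 for all j ≠ k with j, k ≠ i. In particular, the choice u_{ij} = −λ₁ v_j for j ≠ i and u_{ii} = −λ₁ v_i − 2 u_{0i} is feasible. -/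
open scoped InnerProductSpace

/-- Feasible set of the CCS2 QP of host `i` with baseline control `u₀i`:
the host's own constraints carry the factor `2` on `b_ij u₀i`. -/
def ccs2Feasible {N : ℕ} (r l₀ l₁ : ℝ)
    (ξ v : Fin N → EuclideanSpace ℝ (Fin 2)) (i : Fin N)
    (u₀i : EuclideanSpace ℝ (Fin 2))
    (u : Fin N → EuclideanSpace ℝ (Fin 2)) : Prop :=
  (∀ j : Fin N, j ≠ i →
    aConstr r l₀ l₁ ξ v i j + 2 * bConstr ξ i j u₀i
      + bConstr ξ i j (u i - u j) ≥ 0) ∧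
  (∀ j k : Fin N, j ≠ k → j ≠ i → k ≠ i →
    aConstr r l₀ l₁ ξ v j k + bConstr ξ j k (u j - u k) ≥ 0)

/-- The braking controls `-lam • v` satisfy every pairwise constraint on the admissible set,
when `lam` and `l₁ - lam` have product `l₀` and `lam ≤ l₁`. -/
theorem aConstr_add_bConstr_braking_nonneg {N : ℕ} {r l₀ l₁ lam : ℝ}
    {ξ v : Fin N → EuclideanSpace ℝ (Fin 2)} (hle : lam ≤ l₁) (hmul : lam * (l₁ - lam) = l₀)
    (hadm : admissible r lam ξ v) {j k : Fin N} (hjk : j ≠ k) :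
    0 ≤ aConstr r l₀ l₁ ξ v j k + bConstr ξ j k ((-lam) • v j - (-lam) • v k) := by
  have hprod := mul_nonneg (sub_nonneg.2 hle) (hadm j k hjk).2
  rw [aConstr, bConstr, ← smul_sub, real_inner_smul_right, ← hmul]
  nlinarith [sq_nonneg ‖v j - v k‖]

/-- On the admissible set `C*`, the CCS2 constraint set is nonempty; in
particular the choice `u_ij = −λ₁ v_j` for `j ≠ i` and
`u_ii = −λ₁ v_i − 2 u₀i` is feasible. -/
theorem ccs2_feasible
    (N : ℕ) (hN : 2 ≤ N)
    (r l₀ l₁ lam : ℝ) (hr : 0 < r) (hl₀ : 0 < l₀) (hl₁ : 0 < l₁)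
    (hdisc : l₁ ^ 2 ≥ 4 * l₀)
    (hlam : lam = (l₁ + Real.sqrt (l₁ ^ 2 - 4 * l₀)) / 2)
    (ξ v : Fin N → EuclideanSpace ℝ (Fin 2))
    (hadm : admissible r lam ξ v)
    (i : Fin N) (u₀i : EuclideanSpace ℝ (Fin 2)) :
    ccs2Feasible r l₀ l₁ ξ v i u₀i
      (fun j => if j = i then (-lam) • v i - (2 : ℝ) • u₀i else (-lam) • v j)
    ∧ ∃ u : Fin N → EuclideanSpace ℝ (Fin 2), ccs2Feasible r l₀ l₁ ξ v i u₀i u := by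
  have hsq : Real.sqrt (l₁ ^ 2 - 4 * l₀) ^ 2 = l₁ ^ 2 - 4 * l₀ := Real.sq_sqrt (by linarith)
  have hsqrt_le : Real.sqrt (l₁ ^ 2 - 4 * l₀) ≤ l₁ :=
    Real.sqrt_le_iff.2 ⟨hl₁.le, by linarith⟩
  have hle : lam ≤ l₁ := by linarith
  have hmul : lam * (l₁ - lam) = l₀ := by
    rw [hlam]
    linear_combination (-1 / 4) * hsq
  refine (fun h => ⟨h, _, h⟩) ⟨fun j hj => ?_, fun j k hjk hj hk => ?_⟩
  · have h := aConstr_add_bConstr_braking_nonneg hle hmul hadm hj.symm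
    simp only [if_true, if_neg hj]
    rw [sub_right_comm]
    simp only [bConstr, inner_sub_right _ _ ((2 : ℝ) • u₀i), real_inner_smul_right _ u₀i] at h ⊢
    linarith
  · simpa only [if_neg hj, if_neg hk] using
      aConstr_add_bConstr_braking_nonneg hle hmul hadm hjk
end

section
/- Consider N ≥ 2 planar double-integrator agents with state in the admissible set C*, a host agent index i, and a baseline control u_{0i} ∈ ℝ². Then the CCS2 QP — minimize Σ_{j=1}^N ‖u_{ij}‖² over (u_{i1},…,u_{iN}) ∈ (ℝ²)^N subject to a_ij + 2 b_ij u_{0i} + b_ij(u_{ii} − u_{ij}) ≥ 0 for all j ≠ i and a_jk + b_jk(u_{ij} − u_{ik}) ≥ 0 for all j ≠ k with j, k ≠ i — is feasible and has a unique minimizer. -/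
open scoped InnerProductSpace

/-- Cost of the CCS2 QP: `Σ_j ‖u_ij‖²`. -/
noncomputable def ccs2Cost {N : ℕ} (u : Fin N → EuclideanSpace ℝ (Fin 2)) : ℝ :=
  ∑ j : Fin N, ‖u j‖ ^ 2

open Filter in
/-- A common dilation rate `t` makes the control `t • ξ` satisfy every perturbed pairwise
constraint when the agents have pairwise distinct positions. -/
theorem exists_dilation_bConstr_nonneg {N : ℕ} (ξ : Fin N → EuclideanSpace ℝ (Fin 2))
    (hξ : ∀ j k, j ≠ k → ξ j ≠ ξ k) (c : Fin N → Fin N → ℝ) :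
    ∃ t : ℝ, ∀ j k, j ≠ k → 0 ≤ c j k + bConstr ξ j k (t • ξ j - t • ξ k) := by
  have h : ∀ᶠ t : ℝ in atTop, ∀ j k, j ≠ k →
      0 ≤ c j k + bConstr ξ j k (t • ξ j - t • ξ k) := by
    refine eventually_all.2 fun j => eventually_all.2 fun k => ?_
    rcases eq_or_ne j k with hjk | hjk
    · exact Eventually.of_forall fun t h => absurd hjk h
    · have hpos : 0 < 2 * ‖ξ j - ξ k‖ ^ 2 := by
        have := norm_pos_iff.2 (sub_ne_zero.2 (hξ j k hjk))
        positivity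
      filter_upwards [(tendsto_id.atTop_mul_const hpos).eventually_ge_atTop (-c j k)] with t ht _
      rw [bConstr, ← smul_sub, real_inner_smul_right, real_inner_self_eq_norm_sq]
      simp only [id] at ht
      linarith
  exact h.exists

/-- The element of least norm in a nonempty closed convex set, with the quadratic growth of the
squared norm away from it. -/
theorem exists_norm_sq_add_norm_sub_sq_le {E : Type*} [NormedAddCommGroup E]
    [InnerProductSpace ℝ E] [CompleteSpace E] {K : Set E} (hne : K.Nonempty)
    (hclosed : IsClosed K) (hconv : Convex ℝ K) :
    ∃ x ∈ K, ∀ y ∈ K, ‖x‖ ^ 2 + ‖y - x‖ ^ 2 ≤ ‖y‖ ^ 2 := by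
  obtain ⟨x, hx, hmin⟩ := exists_norm_eq_iInf_of_complete_convex hne hclosed.isComplete hconv 0
  refine ⟨x, hx, fun y hy => ?_⟩
  have h := (norm_eq_iInf_iff_real_inner_le_zero hconv hx).1 hmin y hy
  rw [zero_sub, inner_neg_left] at h
  have h2 := norm_add_sq_real x (y - x)
  rw [add_sub_cancel] at h2
  linarith

theorem isClosed_setOf_ccs2Feasible {N : ℕ} (r l₀ l₁ : ℝ)
    (ξ v : Fin N → EuclideanSpace ℝ (Fin 2)) (i : Fin N) (u₀i : EuclideanSpace ℝ (Fin 2)) :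
    IsClosed {u | ccs2Feasible r l₀ l₁ ξ v i u₀i u} := by
  simp only [ccs2Feasible, bConstr, ge_iff_le, Set.ofPred_and, Set.ofPred_forall]
  refine IsClosed.inter ?_ ?_
  · exact isClosed_iInter fun j => isClosed_iInter fun _ =>
      isClosed_le continuous_const (by fun_prop)
  · exact isClosed_iInter fun j => isClosed_iInter fun k => isClosed_iInter fun _ =>
      isClosed_iInter fun _ => isClosed_iInter fun _ => isClosed_le continuous_const (by fun_prop)

theorem bConstr_convex_combination {N : ℕ} (ξ : Fin N → EuclideanSpace ℝ (Fin 2)) (j k : Fin N)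
    (u w : Fin N → EuclideanSpace ℝ (Fin 2)) (a b : ℝ) :
    bConstr ξ j k ((a • u + b • w) j - (a • u + b • w) k) =
      a * bConstr ξ j k (u j - u k) + b * bConstr ξ j k (w j - w k) := by
  simp only [bConstr, Pi.add_apply, Pi.smul_apply, inner_sub_right, inner_add_right,
    real_inner_smul_right]
  ring

theorem convex_setOf_ccs2Feasible {N : ℕ} (r l₀ l₁ : ℝ)
    (ξ v : Fin N → EuclideanSpace ℝ (Fin 2)) (i : Fin N) (u₀i : EuclideanSpace ℝ (Fin 2)) :
    Convex ℝ {u | ccs2Feasible r l₀ l₁ ξ v i u₀i u} := by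
  have key : ∀ {a b c x y : ℝ}, 0 ≤ a → 0 ≤ b → a + b = 1 → c + x ≥ 0 → c + y ≥ 0 →
      c + (a * x + b * y) ≥ 0 := by
    intro a b c x y ha hb hab hx hy
    have : c + (a * x + b * y) = a * (c + x) + b * (c + y) := by
      linear_combination (-c) * hab
    rw [this]
    positivity
  intro u hu w hw a b ha hb hab
  refine ⟨fun j hj => ?_, fun j k hjk hj hk => ?_⟩
  · rw [bConstr_convex_combination]
    exact key ha hb hab (hu.1 j hj) (hw.1 j hj)
  · rw [bConstr_convex_combination]
    exact key ha hb hab (hu.2 j k hjk hj hk) (hw.2 j k hjk hj hk)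

theorem exists_ccs2Feasible {N : ℕ} (r l₀ l₁ : ℝ) (ξ v : Fin N → EuclideanSpace ℝ (Fin 2))
    (hξ : ∀ j k, j ≠ k → ξ j ≠ ξ k) (i : Fin N) (u₀i : EuclideanSpace ℝ (Fin 2)) :
    ∃ u, ccs2Feasible r l₀ l₁ ξ v i u₀i u := by
  obtain ⟨t, ht⟩ := exists_dilation_bConstr_nonneg ξ hξ fun j k =>
    aConstr r l₀ l₁ ξ v j k + if j = i then 2 * bConstr ξ j k u₀i else 0
  refine ⟨fun j => t • ξ j, fun j hj => ?_, fun j k hjk hj _ => ?_⟩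
  · simpa using ht i j hj.symm
  · simpa [hj] using ht j k hjk

theorem admissible.position_ne {N : ℕ} {r lam : ℝ} {ξ v : Fin N → EuclideanSpace ℝ (Fin 2)}
    (hadm : admissible r lam ξ v) (hr : 0 < r) (j k : Fin N) (hjk : j ≠ k) : ξ j ≠ ξ k := by
  intro h
  have h1 := (hadm j k hjk).1
  rw [h, sub_self, norm_zero] at h1
  nlinarith

theorem ccs2Cost_ofLp {N : ℕ} (w : PiLp 2 fun _ : Fin N => EuclideanSpace ℝ (Fin 2)) :
    ccs2Cost w.ofLp = ‖w‖ ^ 2 :=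
  (PiLp.norm_sq_eq_of_L2 _ w).symm

/-- On the admissible set `C*`, the CCS2 QP is feasible and has a unique
minimizer. -/
theorem ccs2_qp_feasible_unique_minimizer
    (N : ℕ) (hN : 2 ≤ N)
    (r l₀ l₁ lam : ℝ) (hr : 0 < r) (hl₀ : 0 < l₀) (hl₁ : 0 < l₁)
    (hdisc : l₁ ^ 2 ≥ 4 * l₀)
    (hlam : lam = (l₁ + Real.sqrt (l₁ ^ 2 - 4 * l₀)) / 2)
    (ξ v : Fin N → EuclideanSpace ℝ (Fin 2))
    (hadm : admissible r lam ξ v)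
    (i : Fin N) (u₀i : EuclideanSpace ℝ (Fin 2)) :
    ∃ ustar : Fin N → EuclideanSpace ℝ (Fin 2),
      ccs2Feasible r l₀ l₁ ξ v i u₀i ustar ∧
      (∀ u, ccs2Feasible r l₀ l₁ ξ v i u₀i u → ccs2Cost ustar ≤ ccs2Cost u) ∧
      (∀ u, ccs2Feasible r l₀ l₁ ξ v i u₀i u →
        ccs2Cost u = ccs2Cost ustar → u = ustar) := by
  let F := PiLp 2 fun _ : Fin N => EuclideanSpace ℝ (Fin 2)
  let K : Set F := {w | ccs2Feasible r l₀ l₁ ξ v i u₀i w.ofLp}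
  have hne : K.Nonempty := by
    obtain ⟨u, hu⟩ := exists_ccs2Feasible r l₀ l₁ ξ v (hadm.position_ne hr) i u₀i
    exact ⟨WithLp.toLp 2 u, hu⟩
  have hclosed : IsClosed K :=
    (isClosed_setOf_ccs2Feasible r l₀ l₁ ξ v i u₀i).preimage (PiLp.continuous_ofLp 2 _)
  have hconv : Convex ℝ K := fun x hx y hy a b ha hb hab =>
    convex_setOf_ccs2Feasible r l₀ l₁ ξ v i u₀i hx hy ha hb hab
  obtain ⟨x, hx, hgrowth⟩ := exists_norm_sq_add_norm_sub_sq_le hne hclosed hconv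
  have hcost : ∀ u, ccs2Feasible r l₀ l₁ ξ v i u₀i u →
      ccs2Cost x.ofLp + ‖WithLp.toLp 2 u - x‖ ^ 2 ≤ ccs2Cost u := by
    intro u hu
    have h := hgrowth (WithLp.toLp 2 u) hu
    rwa [← ccs2Cost_ofLp, ← ccs2Cost_ofLp (WithLp.toLp 2 u)] at h
  refine ⟨x.ofLp, hx, fun u hu => ?_, fun u hu heq => ?_⟩
  · linarith [hcost u hu, sq_nonneg ‖WithLp.toLp 2 u - x‖]
  · have h : ‖WithLp.toLp 2 u - x‖ ^ 2 = 0 :=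
      le_antisymm (by linarith [hcost u hu]) (sq_nonneg _)
    rw [sq_eq_zero_iff, norm_eq_zero, sub_eq_zero] at h
    exact congrArg WithLp.ofLp h
end

section
/- Consider N ≥ 2 planar double-integrator agents with state in the admissible set C*, a host agent index i, and arbitrary disturbance estimates ŵ_j ∈ ℝ² for j ≠ i. Then the PCCA constraint set is nonempty: there exist u_{i1},…,u_{iN} ∈ ℝ² such that a_ij + b_ij(u_{ii} − u_{ij} − ŵ_j) ≥ 0 for all j ≠ i, and a_jk + b_jk(u_{ij} + ŵ_j − u_{ik} − ŵ_k) ≥ 0 for all j ≠ k with j, k ≠ i. In particular, the choice u_{ii} = −λ₁ v_i and u_{ij} = −λ₁ v_j − ŵ_j for j ≠ i is feasible. -/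
open scoped InnerProductSpace

/-- Feasible set of the PCCA QP of host `i` with disturbance estimates `ŵ`. -/
def pccaFeasible {N : ℕ} (r l₀ l₁ : ℝ)
    (ξ v : Fin N → EuclideanSpace ℝ (Fin 2)) (i : Fin N)
    (w : Fin N → EuclideanSpace ℝ (Fin 2))
    (u : Fin N → EuclideanSpace ℝ (Fin 2)) : Prop :=
  (∀ j : Fin N, j ≠ i →
    aConstr r l₀ l₁ ξ v i j + bConstr ξ i j (u i - u j - w j) ≥ 0) ∧
  (∀ j k : Fin N, j ≠ k → j ≠ i → k ≠ i →
    aConstr r l₀ l₁ ξ v j k + bConstr ξ j k (u j + w j - u k - w k) ≥ 0)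

/-- On the admissible set, the damping control `-lam • v_ij` satisfies the pairwise barrier
constraint, whenever `lam ≤ l₁` and `lam` is a root of `s² - l₁ s + l₀`. -/
theorem aConstr_add_bConstr_damping_nonneg {N : ℕ} {r l₀ l₁ lam : ℝ}
    {ξ v : Fin N → EuclideanSpace ℝ (Fin 2)} (hadm : admissible r lam ξ v)
    (hle : lam ≤ l₁) (hroot : (l₁ - lam) * lam = l₀) {i j : Fin N} (hij : i ≠ j) :
    0 ≤ aConstr r l₀ l₁ ξ v i j + bConstr ξ i j ((-lam) • (v i - v j)) := by
  have hbarrier := mul_nonneg (sub_nonneg.2 hle) (hadm i j hij).2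
  rw [aConstr, bConstr, real_inner_smul_right, ← hroot]
  linarith [sq_nonneg ‖v i - v j‖]

/-- On the admissible set `C*`, the PCCA constraint set is nonempty for any
disturbance estimates `ŵ_j`; in particular the choice `u_ii = −λ₁ v_i` and
`u_ij = −λ₁ v_j − ŵ_j` for `j ≠ i` is feasible. -/
theorem pcca_feasible
    (N : ℕ) (hN : 2 ≤ N)
    (r l₀ l₁ lam : ℝ) (hr : 0 < r) (hl₀ : 0 < l₀) (hl₁ : 0 < l₁)
    (hdisc : l₁ ^ 2 ≥ 4 * l₀)
    (hlam : lam = (l₁ + Real.sqrt (l₁ ^ 2 - 4 * l₀)) / 2)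
    (ξ v : Fin N → EuclideanSpace ℝ (Fin 2))
    (hadm : admissible r lam ξ v)
    (i : Fin N) (w : Fin N → EuclideanSpace ℝ (Fin 2)) :
    pccaFeasible r l₀ l₁ ξ v i w
      (fun j => if j = i then (-lam) • v i else (-lam) • v j - w j)
    ∧ ∃ u : Fin N → EuclideanSpace ℝ (Fin 2), pccaFeasible r l₀ l₁ ξ v i w u := by
  have hroot : (l₁ - lam) * lam = l₀ := by
    have hsq := Real.sq_sqrt (sub_nonneg.2 hdisc)
    rw [hlam]
    linarith
  have hle : lam ≤ l₁ := by
    have hlam_pos : 0 < lam := by rw [hlam]; positivity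
    exact sub_nonneg.1 (pos_of_mul_pos_left (hroot ▸ hl₀) hlam_pos.le).le
  have hfeas : pccaFeasible r l₀ l₁ ξ v i w
      (fun j => if j = i then (-lam) • v i else (-lam) • v j - w j) := by
    refine ⟨fun j hj => ?_, fun j k hjk hj hk => ?_⟩
    · have h := aConstr_add_bConstr_damping_nonneg hadm hle hroot hj.symm
      rw [smul_sub] at h
      simpa only [if_true, if_neg hj, sub_sub, sub_add_cancel] using h
    · have h := aConstr_add_bConstr_damping_nonneg hadm hle hroot hjk
      rw [smul_sub] at h
      simpa only [if_neg hj, if_neg hk, sub_sub, sub_add_cancel] using h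
  exact ⟨hfeas, _, hfeas⟩
end

section
/- Let l₀ > 0, l₁ > 0 with l₁² ≥ 4 l₀, and let λ₁ = (l₁ + √(l₁² − 4 l₀))/2 and λ₂ = (l₁ − √(l₁² − 4 l₀))/2 (so λ₁, λ₂ > 0, λ₁ + λ₂ = l₁, λ₁ λ₂ = l₀). Let h : ℝ → ℝ be twice differentiable and suppose h''(t) + l₁ h'(t) + l₀ h(t) ≥ 0 for all t ≥ 0, h(0) ≥ 0, and h'(0) + λ₁ h(0) ≥ 0. Then for all t ≥ 0: h(t) ≥ 0 and h'(t) + λ₁ h(t) ≥ 0. That is, the set C* = {(h, h') : h ≥ 0 and h' + λ₁ h ≥ 0} is forward invariant under the second-order barrier constraint, and along trajectories the original constraint h(t) ≥ 0 is maintained. -/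
/-- A function satisfying `f' + c f ≥ 0` for nonnegative times stays nonnegative if it starts
nonnegative. -/
theorem nonneg_of_hasDerivAt_add_mul_nonneg {f f' : ℝ → ℝ} (c : ℝ)
    (hf : ∀ t, 0 ≤ t → HasDerivAt f (f' t) t) (hf' : ∀ t, 0 ≤ t → 0 ≤ f' t + c * f t)
    (h0 : 0 ≤ f 0) {t : ℝ} (ht : 0 ≤ t) : 0 ≤ f t := by
  have hd : ∀ s, 0 ≤ s →
      HasDerivAt (fun s => Real.exp (c * s) * f s) (Real.exp (c * s) * (f' s + c * f s)) s := by
    intro s hs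
    have he : HasDerivAt (fun s => Real.exp (c * s)) (Real.exp (c * s) * c) s := by
      simpa using ((hasDerivAt_id s).const_mul c).exp
    exact (he.mul (hf s hs)).congr_deriv (by ring)
  have hmono : MonotoneOn (fun s => Real.exp (c * s) * f s) (Set.Ici 0) := by
    refine monotoneOn_of_hasDerivWithinAt_nonneg (convex_Ici 0)
      (fun s hs => (hd s hs).continuousAt.continuousWithinAt)
      (fun s hs => (hd s (interior_subset hs)).hasDerivWithinAt)
      (fun s hs => mul_nonneg (Real.exp_pos _).le (hf' s (interior_subset hs)))
  have hle := hmono Set.self_mem_Ici (Set.mem_Ici.2 ht) ht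
  simp only [mul_zero, Real.exp_zero, one_mul] at hle
  exact nonneg_of_mul_nonneg_right (h0.trans hle) (Real.exp_pos _)

/-- Forward invariance of `C* = {(h, h') : h ≥ 0 ∧ h' + λ₁ h ≥ 0}` under the
second-order barrier constraint `h'' + l₁ h' + l₀ h ≥ 0`, where
`λ₁ = (l₁ + √(l₁² − 4 l₀))/2` is a positive root of `s² + l₁ s + l₀ = 0`.
Along trajectories the original constraint `h(t) ≥ 0` is maintained. -/
theorem second_order_barrier_forward_invariance
    (l₀ l₁ lam₁ lam₂ : ℝ) (hl₀ : 0 < l₀) (hl₁ : 0 < l₁)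
    (hdisc : l₁ ^ 2 ≥ 4 * l₀)
    (hlam₁ : lam₁ = (l₁ + Real.sqrt (l₁ ^ 2 - 4 * l₀)) / 2)
    (hlam₂ : lam₂ = (l₁ - Real.sqrt (l₁ ^ 2 - 4 * l₀)) / 2)
    (h h' h'' : ℝ → ℝ)
    (hderiv : ∀ t : ℝ, HasDerivAt h (h' t) t)
    (hderiv' : ∀ t : ℝ, HasDerivAt h' (h'' t) t)
    (hconstr : ∀ t : ℝ, 0 ≤ t → h'' t + l₁ * h' t + l₀ * h t ≥ 0)
    (h0 : h 0 ≥ 0)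
    (h0' : h' 0 + lam₁ * h 0 ≥ 0) :
    ∀ t : ℝ, 0 ≤ t → h t ≥ 0 ∧ h' t + lam₁ * h t ≥ 0 := by
  have hsum : lam₁ + lam₂ = l₁ := by rw [hlam₁, hlam₂]; ring
  have hprod : lam₁ * lam₂ = l₀ := by
    have hsq := Real.sq_sqrt (sub_nonneg.2 hdisc)
    rw [hlam₁, hlam₂]
    linear_combination -hsq / 4
  have hg : ∀ t, 0 ≤ t → 0 ≤ h' t + lam₁ * h t := fun t ht =>
    nonneg_of_hasDerivAt_add_mul_nonneg (f := fun t => h' t + lam₁ * h t) lam₂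
      (fun s _ => (hderiv' s).add ((hderiv s).const_mul lam₁))
      (fun s hs => by
        have hc := hconstr s hs
        rw [← hsum, ← hprod] at hc
        linarith) h0' ht
  exact fun t ht =>
    ⟨nonneg_of_hasDerivAt_add_mul_nonneg lam₁ (fun s _ => hderiv s) hg h0 ht, hg t ht⟩
end

section
/- Let α : ℝ → ℝ be Lipschitz continuous, strictly increasing, with α(0) = 0 (a Lipschitz class-K function extended to ℝ). Let h : ℝ → ℝ be differentiable and suppose h'(t) ≥ −α(h(t)) for all t ≥ 0 and h(0) ≥ 0. Then h(t) ≥ 0 for all t ≥ 0; i.e., the barrier constraint h' + α(h) ≥ 0 renders the set {h ≥ 0} forward invariant. -/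
/-- CBF invariance: if `α : ℝ → ℝ` is Lipschitz, strictly increasing with
`α(0) = 0` (a Lipschitz class-K function extended to `ℝ`), `h` is
differentiable with `h'(t) ≥ −α(h(t))` for all `t ≥ 0` and `h(0) ≥ 0`, then
`h(t) ≥ 0` for all `t ≥ 0`: the barrier constraint renders `{h ≥ 0}` forward
invariant. -/
theorem cbf_forward_invariance
    (α : ℝ → ℝ)
    (hLip : ∃ K : NNReal, LipschitzWith K α)
    (hMono : StrictMono α)
    (hα0 : α 0 = 0)
    (h h' : ℝ → ℝ)
    (hderiv : ∀ t : ℝ, HasDerivAt h (h' t) t)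
    (hineq : ∀ t : ℝ, 0 ≤ t → h' t ≥ -α (h t))
    (h0 : h 0 ≥ 0) :
    ∀ t : ℝ, 0 ≤ t → h t ≥ 0 := by
  intro t ht
  refine neg_nonpos.mp (le_of_forall_pos_le_add fun ε hε => ?_)
  rw [zero_add]
  refine image_le_of_deriv_right_lt_deriv_boundary (f := fun x => -h x) (f' := fun x => -h' x)
    (B := fun _ => ε) (B' := fun _ => 0) (a := 0) (b := t)
    (fun x _ => (hderiv x).neg.continuousAt.continuousWithinAt)
    (fun x _ => (hderiv x).neg.hasDerivWithinAt) (by linarith)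
    (fun x => hasDerivAt_const x ε) (fun x hx hxε => ?_) (Set.right_mem_Icc.mpr ht)
  have hneg : α (h x) < 0 := hα0 ▸ hMono (show h x < 0 by linarith)
  linarith [hineq x hx.1]
end
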